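/- Let f be a random p-biased function on 𝒳. For every ε ≥ 0, every probability mass function 𝒟* on 𝒳, and every φ : 𝒳 → [0,1], with probability at least 1 − 2·exp(−2ε² / ‖𝒟*‖₂²) over the randomness of f, it holds that |Σ_{x∈𝒳} 𝒟*(x)φ(x)f(x) − p·Σ_{x∈𝒳} 𝒟*(x)φ(x)| ≤ ε. -/

import Mathlib

open Finset Real
open scoped Classical BigOperators

noncomputable section

/-- The real value of a boolean function at a point: `1` if `true`, `0` if `false`. -/
def bval {X : Type} (f : X → Bool) (x : X) : ℝ := if f x then 1 else 0

/-- The probability weight of a particular function `f : X → Bool` when each value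
`f x` is an independent Bernoulli(p) random variable. -/
def bweight {X : Type} [Fintype X] (p : ℝ) (f : X → Bool) : ℝ :=
  ∏ x, if f x then p else 1 - p

/-- The probability of an event `P` under a random `p`-biased function. -/
def bprob (X : Type) [Fintype X] (p : ℝ) (P : (X → Bool) → Prop) : ℝ :=
  ∑ f : X → Bool, bweight p f * (if P f then 1 else 0)

/-- The squared 2-norm of a weight function. -/
def norm2sq {X : Type} [Fintype X] (w : X → ℝ) : ℝ := ∑ x, w x ^ 2

open ProbabilityTheory MeasureTheory in
lemma bern_mgf (p : ℝ) (hp0 : 0 ≤ p) (hp1 : p ≤ 1) (t : ℝ) :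
    p * Real.exp (t * (1 - p)) + (1 - p) * Real.exp (t * (0 - p)) ≤ Real.exp (t ^ 2 / 8) := by
  let μ : Measure Bool := ENNReal.ofReal p • Measure.dirac true
    + ENNReal.ofReal (1 - p) • Measure.dirac false
  have hμ : IsProbabilityMeasure μ := by
    constructor
    simp only [μ, Measure.add_apply, Measure.smul_apply, measure_univ, smul_eq_mul, mul_one]
    rw [← ENNReal.ofReal_add hp0 (by linarith)]
    simp
  have hint : ∀ g : Bool → ℝ, ∫ b, g b ∂μ = p * g true + (1 - p) * g false := by
    intro g
    rw [integral_add_measure (Integrable.of_finite.smul_measure ENNReal.ofReal_ne_top)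
        (Integrable.of_finite.smul_measure ENNReal.ofReal_ne_top),
      integral_smul_measure, integral_smul_measure, integral_dirac, integral_dirac,
      ENNReal.toReal_ofReal hp0, ENNReal.toReal_ofReal (by linarith)]
    simp
  have h := hasSubgaussianMGF_of_mem_Icc_of_integral_eq_zero (μ := μ) (a := 0 - p) (b := 1 - p)
    (X := fun b : Bool => (if b then 1 else 0) - p) (measurable_of_finite _).aemeasurable
    (Filter.Eventually.of_forall (by intro b; cases b <;> simp)) (by rw [hint]; simp; ring)
  have h2 := h.mgf_le t
  rw [mgf, hint] at h2
  simp only [if_true, Bool.false_eq_true, if_false] at h2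
  refine h2.trans (le_of_eq ?_)
  congr 1
  simp
  ring

lemma bweight_nonneg {X : Type} [Fintype X] (p : ℝ) (hp0 : 0 ≤ p) (hp1 : p ≤ 1) (f : X → Bool) :
    0 ≤ bweight p f := by
  unfold bweight
  refine Finset.prod_nonneg fun x _ => ?_
  split_ifs <;> linarith

lemma sum_prod_bool {X : Type} [Fintype X] (g : X → Bool → ℝ) :
    ∑ f : X → Bool, ∏ x, g x (f x) = ∏ x, (g x true + g x false) := by
  have h := Finset.prod_univ_sum (fun _ : X => (Finset.univ : Finset Bool)) g
  simp only [Fintype.piFinset_univ, Fintype.sum_bool] at h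
  exact h.symm

lemma bweight_sum {X : Type} [Fintype X] (p : ℝ) : ∑ f : X → Bool, bweight p f = 1 := by
  unfold bweight
  rw [sum_prod_bool (fun _ b => if b then p else 1 - p)]
  simp

lemma tail {X : Type} [Fintype X] (p : ℝ) (hp0 : 0 ≤ p) (hp1 : p ≤ 1)
    (ε : ℝ) (hε : 0 ≤ ε) (a : X → ℝ) (V : ℝ) (hV : 0 < V) (ha : ∑ x, a x ^ 2 ≤ V) :
    bprob X p (fun f => ε < ∑ x, a x * (bval f x - p)) ≤ Real.exp (-(2 * ε ^ 2) / V) := by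
  set t := 4 * ε / V with ht
  have ht0 : 0 ≤ t := by positivity
  have h1 : bprob X p (fun f => ε < ∑ x, a x * (bval f x - p)) ≤
      ∑ f : X → Bool, bweight p f * (Real.exp (-(t * ε)) *
        Real.exp (t * ∑ x, a x * (bval f x - p))) := by
    unfold bprob
    refine Finset.sum_le_sum fun f _ => mul_le_mul_of_nonneg_left ?_ (bweight_nonneg p hp0 hp1 f)
    split_ifs with h
    · rw [← Real.exp_add, Real.one_le_exp_iff]
      nlinarith [mul_le_mul_of_nonneg_left h.le ht0]
    · positivity
  have h2 : ∑ f : X → Bool, bweight p f * (Real.exp (-(t * ε)) *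
        Real.exp (t * ∑ x, a x * (bval f x - p))) = Real.exp (-(t * ε)) *
      ∏ x, (p * Real.exp (t * a x * (1 - p)) + (1 - p) * Real.exp (t * a x * (0 - p))) := by
    have := sum_prod_bool (fun (x : X) b => (if b then p else 1 - p) *
      Real.exp (t * a x * ((if b then 1 else 0) - p)))
    simp only [if_true, Bool.false_eq_true, if_false] at this
    rw [← this, Finset.mul_sum]
    refine Finset.sum_congr rfl fun f _ => ?_
    rw [Finset.prod_mul_distrib, ← Real.exp_sum, Finset.mul_sum]
    simp only [bweight, bval, mul_assoc]
    ring
  have h3 : ∏ x, (p * Real.exp (t * a x * (1 - p)) + (1 - p) * Real.exp (t * a x * (0 - p)))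
      ≤ Real.exp (t ^ 2 * V / 8) := by
    calc _ ≤ ∏ x, Real.exp ((t * a x) ^ 2 / 8) := by
          refine Finset.prod_le_prod (fun x _ => ?_) (fun x _ => bern_mgf p hp0 hp1 _)
          have : 0 ≤ 1 - p := by linarith
          positivity
      _ = Real.exp (t ^ 2 * (∑ x, a x ^ 2) / 8) := by
          rw [← Real.exp_sum, Finset.mul_sum, Finset.sum_div]
          simp only [mul_pow]
      _ ≤ _ := by gcongr
  calc _ ≤ _ := h1
    _ = _ := h2
    _ ≤ Real.exp (-(t * ε)) * Real.exp (t ^ 2 * V / 8) := by gcongr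
    _ = _ := by
      rw [← Real.exp_add, ht]
      congr 1
      field_simp
      ring

theorem stmt3 {X : Type} [Fintype X] (p : ℝ) (hp0 : 0 ≤ p) (hp1 : p ≤ 1)
    (ε : ℝ) (hε : 0 ≤ ε) (Ds φ : X → ℝ)
    (hDs0 : ∀ x, 0 ≤ Ds x) (hDs1 : ∀ x, Ds x ≤ 1) (hDssum : ∑ x, Ds x = 1)
    (hφ0 : ∀ x, 0 ≤ φ x) (hφ1 : ∀ x, φ x ≤ 1) :
    bprob X p (fun f =>
        |(∑ x, Ds x * φ x * bval f x) - p * ∑ x, Ds x * φ x| ≤ ε) ≥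
      1 - 2 * Real.exp (-(2 * ε ^ 2) / norm2sq Ds) := by
  have hV : 0 < norm2sq Ds := by
    unfold norm2sq
    refine lt_of_le_of_ne (Finset.sum_nonneg fun x _ => sq_nonneg _) fun h => ?_
    have h0 := (Finset.sum_eq_zero_iff_of_nonneg (fun x _ => sq_nonneg (Ds x))).1 h.symm
    have : ∑ x, Ds x = 0 := Finset.sum_eq_zero fun x hx => by
      simpa using h0 x hx
    linarith
  have hle : ∑ x, (Ds x * φ x) ^ 2 ≤ norm2sq Ds := by
    unfold norm2sq
    refine Finset.sum_le_sum fun x _ => ?_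
    have := mul_le_of_le_one_right (hDs0 x) (hφ1 x)
    have h' := mul_nonneg (hDs0 x) (hφ0 x)
    gcongr
  have t1 := tail p hp0 hp1 ε hε (fun x => Ds x * φ x) _ hV hle
  have t2 := tail p hp0 hp1 ε hε (fun x => -(Ds x * φ x)) _ hV (by simpa using hle)
  have key : 1 ≤ bprob X p (fun f =>
        |(∑ x, Ds x * φ x * bval f x) - p * ∑ x, Ds x * φ x| ≤ ε) +
      bprob X p (fun f => ε < ∑ x, (Ds x * φ x) * (bval f x - p)) +
      bprob X p (fun f => ε < ∑ x, -(Ds x * φ x) * (bval f x - p)) := by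
    rw [← bweight_sum (X := X) p]
    unfold bprob
    rw [← Finset.sum_add_distrib, ← Finset.sum_add_distrib]
    refine Finset.sum_le_sum fun f _ => ?_
    rw [← mul_add, ← mul_add]
    refine le_mul_of_one_le_right (bweight_nonneg p hp0 hp1 f) ?_
    have e1 : ∑ x, (Ds x * φ x) * (bval f x - p) =
        (∑ x, Ds x * φ x * bval f x) - p * ∑ x, Ds x * φ x := by
      rw [Finset.mul_sum, ← Finset.sum_sub_distrib]
      exact Finset.sum_congr rfl fun x _ => by ring
    have e2 : ∑ x, -(Ds x * φ x) * (bval f x - p) =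
        -((∑ x, Ds x * φ x * bval f x) - p * ∑ x, Ds x * φ x) := by
      rw [← e1, ← Finset.sum_neg_distrib]
      exact Finset.sum_congr rfl fun x _ => by ring
    simp only [e1, e2]
    split_ifs with h1 h2 h3 h3 h2 h3 h3 <;> norm_num
    exact h1 (abs_le.2 ⟨by linarith, by linarith⟩)
  linarith

end
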